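/- arXiv:2205.09994 — 2 statements merged into one kernel-verified Lean document; each statement's English description precedes it below -/
import Mathlib

section
/- Let t_K = ⊕_{i=1}^m C·[e_{β_i}, e_{-β_i}] ⊂ t be the C-span of the cascade K (under the Killing identification of t and t*), and let b_K = t_K ⊕ u⁺ be the Frobenius envelope of u⁺, which is a Frobenius Lie algebra (ind b_K = 0). Identify b_K* with t_K ⊕ u⁻ via the Killing form, and set ξ_K = Σ_{β∈K} e_{-β} ∈ b_K*. Then ξ_K is a regular element of b_K* (its stabiliser in b_K is zero) and (ad* x_K)·ξ_K = -ξ_K; that is, the cascade element x_K is the Ooms element of b_K associated with ξ_K. Consequently, the multiset of eigenvalues of ad x_K on b_K is symmetric with respect to 1/2. -/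
open scoped RealInnerProductSpace

attribute [local instance] Classical.propDecidable

section RootCombinatorics

variable {V : Type*} [NormedAddCommGroup V] [InnerProductSpace ℝ V]

/-- The Cartan pairing `⟨γ, α∨⟩ = 2 (γ, α) / (α, α)`. -/
noncomputable def cartanPairing (γ α : V) : ℝ := 2 * ⟪γ, α⟫ / ⟪α, α⟫

/-- The coroot `γ∨ = 2 γ / (γ, γ)`. -/
noncomputable def covec (γ : V) : V := (2 / ⟪γ, γ⟫) • γ

/-- The cascade element `x_K = Σ_{β ∈ K} β / (β, β) = ½ Σ_{β ∈ K} β∨`. -/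
noncomputable def cascElt (K : Finset V) : V := ∑ β ∈ K, (⟪β, β⟫)⁻¹ • β

/-- The roots of `S` orthogonal to `β`. -/
noncomputable def orthSub (S : Finset V) (β : V) : Finset V := S.filter fun γ => ⟪γ, β⟫ = 0

/-- One step of the non-orthogonality (connectedness) relation inside `S`. -/
def connRel (S : Finset V) (a b : V) : Prop := a ∈ S ∧ b ∈ S ∧ ⟪a, b⟫ ≠ 0

/-- The irreducible component of the root subsystem `S` containing `γ`. -/
noncomputable def component (S : Finset V) (γ : V) : Finset V :=
  S.filter fun γ' => Relation.ReflTransGen (connRel S) γ γ'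

/-- `C` is an irreducible component of the root subsystem `S`. -/
def IsComponent (S C : Finset V) : Prop := ∃ γ ∈ S, C = component S γ

end RootCombinatorics

/-- The combinatorial data of an irreducible crystallographic root system with a chosen
system of positive roots, base (set of simple roots) and highest root: the combinatorial
skeleton of a finite-dimensional complex simple Lie algebra, with the Killing-form
identification of the Cartan subalgebra and its dual. -/
structure RootSystemCtx (V : Type*) [NormedAddCommGroup V] [InnerProductSpace ℝ V] where
  /-- the set of roots Δ -/
  Δ : Finset V
  /-- the set of simple roots Π -/
  base : Finset V
  /-- the set of positive roots Δ⁺ -/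
  Pos : Finset V
  /-- the highest root θ -/
  θ : V
  zero_not_mem : (0 : V) ∉ Δ
  neg_mem : ∀ γ ∈ Δ, -γ ∈ Δ
  reflect_mem : ∀ α ∈ Δ, ∀ γ ∈ Δ, γ - cartanPairing γ α • α ∈ Δ
  pairing_int : ∀ α ∈ Δ, ∀ γ ∈ Δ, ∃ k : ℤ, cartanPairing γ α = (k : ℝ)
  span_eq : Submodule.span ℝ (Δ : Set V) = ⊤
  base_subset : base ⊆ Pos
  base_indep : LinearIndependent ℝ (fun a : {x // x ∈ base} => (a : V))
  pos_subset : Pos ⊆ Δ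
  pos_or_neg : ∀ γ ∈ Δ, γ ∈ Pos ∨ -γ ∈ Pos
  pos_not_neg : ∀ γ ∈ Pos, -γ ∉ Pos
  pos_coords : ∀ γ ∈ Pos, γ ∈ AddSubmonoid.closure (base : Set V)
  irreducible : ∀ S : Finset V, S ⊆ Δ → S.Nonempty →
    (∀ a ∈ S, ∀ b ∈ Δ, b ∉ S → ⟪a, b⟫ = 0) → S = Δ
  theta_mem : θ ∈ Pos
  theta_highest : ∀ γ ∈ Δ, θ - γ ∈ AddSubmonoid.closure (base : Set V)

namespace RootSystemCtx

variable {V : Type*} [NormedAddCommGroup V] [InnerProductSpace ℝ V]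

variable (ctx : RootSystemCtx V)

/-- The root order `γ ≼ γ'` on roots: `γ' - γ` is a nonnegative integral combination of
simple roots. -/
def rootLE (γ γ' : V) : Prop := γ' - γ ∈ AddSubmonoid.closure (ctx.base : Set V)

/-- `β` is the highest root of the root subsystem `S` (with respect to the ambient positive
system). -/
def IsHighest (S : Finset V) (β : V) : Prop :=
  β ∈ S ∧ β ∈ ctx.Pos ∧ ∀ γ ∈ S, ctx.rootLE γ β

/-- `CascadeMem ctx S β` : the pair (root subsystem `S = Δ⟨i⟩`, its highest root `β = βᵢ`)
occurs in the recursive construction of the Kostant cascade: one starts with `(Δ, θ)`, and the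
descendants of `(S, β)` are the pairs `(C, β')` where `C` is an irreducible component of
`{γ ∈ S | (γ, β) = 0}` and `β'` is the highest root of `C`. -/
inductive CascadeMem : Finset V → V → Prop
  | top : CascadeMem ctx.Δ ctx.θ
  | step {S C : Finset V} {β β' : V} : CascadeMem S β →
      IsComponent (orthSub S β) C → ctx.IsHighest C β' → CascadeMem C β'

/-- `K` is the Kostant cascade of the root system. -/
def IsCascade (K : Finset V) : Prop := ∀ β, β ∈ K ↔ ∃ S, ctx.CascadeMem S β

/-- The Heisenberg subset `H_β = {γ ∈ S ∩ Δ⁺ : (γ, β) > 0}` attached to a cascade pair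
`(S, β)`. -/
noncomputable def heis (S : Finset V) (β : V) : Finset V :=
  S.filter fun γ => γ ∈ ctx.Pos ∧ 0 < ⟪γ, β⟫

/-- A root is long if it has the same length as the highest root. -/
def IsLong (γ : V) : Prop := ⟪γ, γ⟫ = ⟪ctx.θ, ctx.θ⟫

/-- The highest root `θ` is a fundamental weight. -/
def ThetaFundamental : Prop :=
  ∃ α ∈ ctx.base, cartanPairing ctx.θ α = 1 ∧
    ∀ β ∈ ctx.base, β ≠ α → cartanPairing ctx.θ β = 0

/-- `β'` is a descendant of the cascade element `β`. -/
def Desc (β β' : V) : Prop :=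
  ∃ S C, ctx.CascadeMem S β ∧ IsComponent (orthSub S β) C ∧ ctx.IsHighest C β'

/-- The cascade poset order: `β ≤ β'` iff `β` is an iterated descendant of `β'`. -/
def cascLE (β β' : V) : Prop := Relation.ReflTransGen (fun a b => ctx.Desc b a) β β'

/-- A simple reflection of the root system. -/
def IsSimpleReflection (w : V ≃ₗ[ℝ] V) : Prop :=
  ∃ α ∈ ctx.base, ∀ v, w v = v - (2 * ⟪v, α⟫ / ⟪α, α⟫) • α

/-- The Weyl group, generated by the simple reflections. -/
def weylGroup : Subgroup (V ≃ₗ[ℝ] V) := Subgroup.closure {w | ctx.IsSimpleReflection w}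

/-- The length of a Weyl group element: the minimal number of simple reflections needed to
express it. -/
noncomputable def length (w : V ≃ₗ[ℝ] V) : ℕ :=
  sInf {n | ∃ l : List (V ≃ₗ[ℝ] V), l.length = n ∧
    (∀ s ∈ l, ctx.IsSimpleReflection s) ∧ l.prod = w}

/-- The root system is of type `Aₙ` (Cartan matrix characterisation). -/
def IsTypeA (n : ℕ) : Prop :=
  1 ≤ n ∧ ∃ e : Fin n ≃ {x // x ∈ ctx.base}, ∀ i j : Fin n,
    cartanPairing (e i : V) (e j : V) =
      (if i = j then 2 else if i.val + 1 = j.val ∨ j.val + 1 = i.val then -1 else 0)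

/-- The root system is of type `Bₙ` (`n ≥ 2`), with the last simple root short. -/
def IsTypeB (n : ℕ) : Prop :=
  2 ≤ n ∧ ∃ e : Fin n ≃ {x // x ∈ ctx.base}, ∀ i j : Fin n,
    cartanPairing (e i : V) (e j : V) =
      (if i = j then 2
       else if i.val + 2 = n ∧ j.val + 1 = n then -2
       else if i.val + 1 = j.val ∨ j.val + 1 = i.val then -1 else 0)

/-- The root system is of type `Cₙ` (`n ≥ 2`), with the last simple root long. -/
def IsTypeC (n : ℕ) : Prop :=
  2 ≤ n ∧ ∃ e : Fin n ≃ {x // x ∈ ctx.base}, ∀ i j : Fin n,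
    cartanPairing (e i : V) (e j : V) =
      (if i = j then 2
       else if i.val + 1 = n ∧ j.val + 2 = n then -2
       else if i.val + 1 = j.val ∨ j.val + 1 = i.val then -1 else 0)

/-- The root system is of type `G₂` (first simple root short). -/
def IsTypeG2 : Prop :=
  ∃ e : Fin 2 ≃ {x // x ∈ ctx.base},
    cartanPairing (e 0 : V) (e 0 : V) = 2 ∧ cartanPairing (e 1 : V) (e 1 : V) = 2 ∧
    cartanPairing (e 0 : V) (e 1 : V) = -1 ∧ cartanPairing (e 1 : V) (e 0 : V) = -3

/-- The set of roots `Δ(a_z) = w(Δ⁺_z(-1)) ∪ w(-Δ⁺_z(2))` of the abelian ideal attached by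
Kostant's construction to `z` (with `w = w_z`). -/
def idealSet (w : V ≃ₗ[ℝ] V) (x : V) : Set V :=
  {δ | ∃ γ ∈ ctx.Pos, (⟪γ, x⟫ = -1 ∧ δ = w γ) ∨ (⟪γ, x⟫ = 2 ∧ δ = -(w γ))}

end RootSystemCtx

/-- A root-space decomposition of a finite-dimensional complex Lie algebra `g` compatible
with the root-system data `ctx`: a Cartan subalgebra `t`, root vectors `e γ` for `γ ∈ Δ`,
and the Killing identification `coh : V → t` of the rational/real form of the Cartan
subalgebra with the Euclidean space `V` carrying the root system. -/
structure LieRootData {V : Type*} [NormedAddCommGroup V] [InnerProductSpace ℝ V]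
    (ctx : RootSystemCtx V) (g : Type*) [LieRing g] [LieAlgebra ℂ g] where
  t : LieSubalgebra ℂ g
  e : V → g
  coh : V → g
  coh_add : ∀ v w, coh (v + w) = coh v + coh w
  coh_smul : ∀ (r : ℝ) (v : V), coh (r • v) = (r : ℂ) • coh v
  coh_inj : ∀ v, coh v = 0 → v = 0
  coh_mem : ∀ v, coh v ∈ t
  t_span : t.toSubmodule = Submodule.span ℂ (Set.range coh)
  t_abelian : ∀ x ∈ t, ∀ y ∈ t, ⁅x, y⁆ = (0 : g)
  e_ne : ∀ γ ∈ ctx.Δ, e γ ≠ 0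
  bracket_coh_e : ∀ (v : V), ∀ γ ∈ ctx.Δ, ⁅coh v, e γ⁆ = (⟪γ, v⟫ : ℂ) • e γ
  bracket_e_e_root : ∀ γ ∈ ctx.Δ, ∀ δ ∈ ctx.Δ, γ + δ ∈ ctx.Δ →
    ∃ c : ℂ, c ≠ 0 ∧ ⁅e γ, e δ⁆ = c • e (γ + δ)
  bracket_e_e_neg : ∀ γ ∈ ctx.Δ, ∃ c : ℂ, c ≠ 0 ∧ ⁅e γ, e (-γ)⁆ = c • coh γ
  bracket_e_e_zero : ∀ γ ∈ ctx.Δ, ∀ δ ∈ ctx.Δ, γ + δ ∉ ctx.Δ → γ + δ ≠ 0 → ⁅e γ, e δ⁆ = 0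
  span_top : (⊤ : Submodule ℂ g) = t.toSubmodule ⊔ Submodule.span ℂ (e '' (ctx.Δ : Set V))
  dim_eq : Module.finrank ℂ g = Module.finrank ℂ ↥t + ctx.Δ.card
  rank_eq : Module.finrank ℂ ↥t = ctx.base.card

section CascadeCombinatorics

variable {V : Type*} [NormedAddCommGroup V] [InnerProductSpace ℝ V]

namespace RootSystemCtx

variable (ctx : RootSystemCtx V)

theorem ne_zero_of_mem {γ : V} (h : γ ∈ ctx.Δ) : γ ≠ 0 := fun h0 => ctx.zero_not_mem (h0 ▸ h)

theorem inner_self_pos {γ : V} (h : γ ∈ ctx.Δ) : 0 < ⟪γ, γ⟫ :=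
  real_inner_self_pos.2 (ctx.ne_zero_of_mem h)

/-- There is a height functional, which is positive on the nonzero elements of the cone
generated by the base. -/
theorem exists_height : ∃ f : V →ₗ[ℝ] ℝ, ∀ x ∈ AddSubmonoid.closure (ctx.base : Set V),
    0 ≤ f x ∧ (f x = 0 → x = 0) := by
  obtain ⟨f, hf⟩ := LinearMap.exists_extend
    ((Module.Basis.span ctx.base_indep).constr ℝ (fun _ => (1 : ℝ)))
  have hb : ∀ a ∈ ctx.base, f a = 1 := by
    intro a ha
    have h1 := LinearMap.congr_fun hf (Module.Basis.span ctx.base_indep ⟨a, ha⟩)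
    rw [Module.Basis.constr_basis] at h1
    rw [← h1]
    simp [Module.Basis.span_apply]
  refine ⟨f, fun x hx => ?_⟩
  induction hx using AddSubmonoid.closure_induction with
  | mem x hx => simp [hb x hx]
  | zero => simp
  | add x y _ _ h1 h2 =>
    refine ⟨by rw [map_add]; linarith [h1.1, h2.1], fun h => ?_⟩
    rw [map_add] at h
    rw [h1.2 (by linarith [h1.1, h2.1]), h2.2 (by linarith [h1.1, h2.1]), add_zero]

theorem eq_zero_of_cone {x : V} (h1 : x ∈ AddSubmonoid.closure (ctx.base : Set V))
    (h2 : -x ∈ AddSubmonoid.closure (ctx.base : Set V)) : x = 0 := by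
  obtain ⟨f, hf⟩ := ctx.exists_height
  have h3 := (hf _ h2).1
  rw [map_neg] at h3
  exact (hf _ h1).2 (by linarith [(hf _ h1).1])

theorem sub_mem {γ δ : V} (hγ : γ ∈ ctx.Δ) (hδ : δ ∈ ctx.Δ) (h : 0 < ⟪γ, δ⟫) (hne : γ ≠ δ) :
    γ - δ ∈ ctx.Δ := by
  obtain ⟨k, hk⟩ := ctx.pairing_int δ hδ γ hγ
  obtain ⟨l, hl⟩ := ctx.pairing_int γ hγ δ hδ
  have h1 := ctx.reflect_mem δ hδ γ hγ
  have h2 := ctx.reflect_mem γ hγ δ hδ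
  rw [hk] at h1
  rw [hl] at h2
  have pγ := ctx.inner_self_pos hγ
  have pδ := ctx.inner_self_pos hδ
  have hk' : 2 * ⟪γ, δ⟫ = k * ⟪δ, δ⟫ := by
    rw [cartanPairing, div_eq_iff pδ.ne'] at hk
    exact hk
  have hl' : 2 * ⟪γ, δ⟫ = l * ⟪γ, γ⟫ := by
    rw [cartanPairing, div_eq_iff pγ.ne', real_inner_comm] at hl
    exact hl
  have kpos : 0 < k := by
    have : (0 : ℝ) < k := by
      by_contra hc
      nlinarith
    exact_mod_cast this
  have lpos : 0 < l := by
    have : (0 : ℝ) < l := by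
      by_contra hc
      nlinarith
    exact_mod_cast this
  rcases eq_or_lt_of_le (show 1 ≤ k by omega) with hk1 | hk1
  · rw [← hk1] at h1
    simpa using h1
  rcases eq_or_lt_of_le (show 1 ≤ l by omega) with hl1 | hl1
  · rw [← hl1] at h2
    simpa using ctx.neg_mem _ h2
  exfalso
  have k2 : (2 : ℝ) ≤ k := by exact_mod_cast hk1
  have l2 : (2 : ℝ) ≤ l := by exact_mod_cast hl1
  have e1 : ⟪δ, δ⟫ ≤ ⟪γ, δ⟫ := by nlinarith
  have e2 : ⟪γ, γ⟫ ≤ ⟪γ, δ⟫ := by nlinarith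
  have e3 : ⟪γ - δ, γ - δ⟫ ≤ 0 := by
    rw [real_inner_sub_sub_self]
    linarith
  exact hne (sub_eq_zero.1 (real_inner_self_nonpos.1 e3))

theorem add_mem {γ δ : V} (hγ : γ ∈ ctx.Pos) (hδ : δ ∈ ctx.Pos) (h : ⟪γ, δ⟫ < 0) :
    γ + δ ∈ ctx.Δ := by
  have := ctx.sub_mem (ctx.pos_subset hγ) (ctx.neg_mem _ (ctx.pos_subset hδ))
    (by rw [inner_neg_right]; linarith)
    (fun he => ctx.pos_not_neg δ hδ (he ▸ hγ))
  simpa using this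

theorem mem_pos_of_cone {γ : V} (hγ : γ ∈ ctx.Δ)
    (h : γ ∈ AddSubmonoid.closure (ctx.base : Set V)) : γ ∈ ctx.Pos := by
  rcases ctx.pos_or_neg γ hγ with h1 | h1
  · exact h1
  · exact absurd (ctx.eq_zero_of_cone h (ctx.pos_coords _ h1)) (ctx.ne_zero_of_mem hγ)

/-- A root subsystem that contains every root of the planes spanned by its elements. -/
def IsSubsystem (S : Finset V) : Prop :=
  S ⊆ ctx.Δ ∧ ∀ a ∈ S, ∀ b ∈ S, ∀ r s : ℝ, r • a + s • b ∈ ctx.Δ → r • a + s • b ∈ S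

variable {ctx}

theorem IsSubsystem.neg {S : Finset V} (hS : ctx.IsSubsystem S) {a : V} (ha : a ∈ S) :
    -a ∈ S := by
  have := hS.2 a ha a ha (-1) 0 (by simpa using ctx.neg_mem a (hS.1 ha))
  simpa using this

theorem IsSubsystem.add {S : Finset V} (hS : ctx.IsSubsystem S) {a b : V} (ha : a ∈ S)
    (hb : b ∈ S) (h : a + b ∈ ctx.Δ) : a + b ∈ S := by
  have := hS.2 a ha b hb 1 1 (by simpa using h)
  simpa using this

theorem IsSubsystem.sub {S : Finset V} (hS : ctx.IsSubsystem S) {a b : V} (ha : a ∈ S)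
    (hb : b ∈ S) (h : a - b ∈ ctx.Δ) : a - b ∈ S := by
  have := hS.2 a ha b hb 1 (-1) (by simpa [sub_eq_add_neg] using h)
  simpa [sub_eq_add_neg] using this

theorem IsSubsystem.sub_smul {S : Finset V} (hS : ctx.IsSubsystem S) {a b : V} (ha : a ∈ S)
    (hb : b ∈ S) (r : ℝ) (h : a - r • b ∈ ctx.Δ) : a - r • b ∈ S := by
  have := hS.2 a ha b hb 1 (-r) (by simpa [sub_eq_add_neg] using h)
  simpa [sub_eq_add_neg] using this

theorem IsSubsystem.orthSub {S : Finset V} (hS : ctx.IsSubsystem S) (β : V) :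
    ctx.IsSubsystem (orthSub S β) := by
  refine ⟨(Finset.filter_subset _ _).trans hS.1, fun a ha b hb r s h => ?_⟩
  simp only [_root_.orthSub, Finset.mem_filter] at ha hb ⊢
  refine ⟨hS.2 a ha.1 b hb.1 r s h, ?_⟩
  rw [inner_add_left, inner_smul_left, inner_smul_left, ha.2, hb.2]
  simp

theorem mem_component_of_inner_ne_zero {S : Finset V} {γ a b : V} (ha : a ∈ component S γ)
    (hb : b ∈ S) (h : ⟪a, b⟫ ≠ 0) : b ∈ component S γ := by
  simp only [component, Finset.mem_filter] at ha ⊢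
  exact ⟨hb, ha.2.tail ⟨ha.1, hb, h⟩⟩

theorem IsSubsystem.component {S : Finset V} (hS : ctx.IsSubsystem S) (γ : V) :
    ctx.IsSubsystem (component S γ) := by
  have hsub : _root_.component S γ ⊆ S := Finset.filter_subset _ _
  refine ⟨hsub.trans hS.1, fun a ha b hb r s h => ?_⟩
  have hx := hS.2 a (hsub ha) b (hsub hb) r s h
  by_cases h1 : ⟪a, r • a + s • b⟫ = 0
  · by_cases h2 : ⟪b, r • a + s • b⟫ = 0
    · refine absurd ?_ (ctx.inner_self_pos h).ne'
      conv_lhs => rw [inner_add_left, inner_smul_left, inner_smul_left, h1, h2]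
      simp
    · exact mem_component_of_inner_ne_zero hb hx h2
  · exact mem_component_of_inner_ne_zero ha hx h1

theorem connRel_symm (S : Finset V) : Std.Symm (connRel S) :=
  ⟨fun _ _ h => ⟨h.2.1, h.1, by rw [real_inner_comm]; exact h.2.2⟩⟩

theorem reflTransGen_of_mem_component {S : Finset V} {γ a b : V} (ha : a ∈ component S γ)
    (hb : b ∈ component S γ) : Relation.ReflTransGen (connRel S) a b := by
  simp only [component, Finset.mem_filter] at ha hb
  have := connRel_symm S
  exact (Std.Symm.symm _ _ ha.2).trans hb.2

theorem component_eq_of_mem {S : Finset V} {γ a : V} (ha : a ∈ component S γ) :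
    component S γ = component S a := by
  have ha' := ha
  simp only [component, Finset.mem_filter] at ha
  ext b
  refine ⟨fun hb => ?_, fun hb => ?_⟩
  · have := reflTransGen_of_mem_component ha' hb
    simp only [component, Finset.mem_filter] at hb ⊢
    exact ⟨hb.1, this⟩
  · simp only [component, Finset.mem_filter] at hb ⊢
    exact ⟨hb.1, ha.2.trans hb.2⟩

/-- Two components with non-orthogonal elements coincide. -/
theorem component_eq_of_inner_ne_zero {S : Finset V} {γ γ' a b : V} (ha : a ∈ component S γ)
    (hb : b ∈ component S γ') (h : ⟪a, b⟫ ≠ 0) : component S γ = component S γ' := by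
  rw [component_eq_of_mem (mem_component_of_inner_ne_zero ha (Finset.filter_subset _ _ hb) h),
    ← component_eq_of_mem hb]

theorem component_induction {S : Finset V} {γ a : V} (P : V → Prop) (ha : a ∈ component S γ)
    (hP : P a)
    (h : ∀ x ∈ component S γ, ∀ y ∈ component S γ, ⟪x, y⟫ ≠ 0 → P x → P y) :
    ∀ b ∈ component S γ, P b := by
  intro b hb
  have key : b ∈ component S γ ∧ P b := by
    have hab := reflTransGen_of_mem_component ha hb
    clear hb
    induction hab with
    | refl => exact ⟨ha, hP⟩
    | tail _ hxy ih =>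
      have hy := mem_component_of_inner_ne_zero ih.1 hxy.2.1 hxy.2.2
      exact ⟨hy, h _ ih.1 _ hy hxy.2.2 ih.2⟩
  exact key.2

/-- A root of `S` that is maximal for the root order is dominant with respect to `S`. -/
theorem IsSubsystem.inner_nonneg_of_maximal {S : Finset V} (hS : ctx.IsSubsystem S) {β γ : V}
    (hβ : β ∈ S) (hmax : ∀ x ∈ S, ctx.rootLE β x → x = β) (hβp : β ∈ ctx.Pos)
    (hγ : γ ∈ S) (hγp : γ ∈ ctx.Pos) : 0 ≤ ⟪γ, β⟫ := by
  by_contra! h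
  have h1 := ctx.add_mem hγp hβp h
  have h2 := hmax _ (hS.add hγ hβ h1) (by
    rw [rootLE, add_sub_cancel_right]
    exact ctx.pos_coords _ hγp)
  exact ctx.ne_zero_of_mem (hS.1 hγ) (by simpa using h2)

theorem IsHighest.maximal {S : Finset V} {β : V} (h : ctx.IsHighest S β) :
    ∀ x ∈ S, ctx.rootLE β x → x = β := by
  intro x hx hle
  have h1 := h.2.2 x hx
  rw [rootLE] at h1 hle
  exact sub_eq_zero.1 (ctx.eq_zero_of_cone hle (by simpa using h1))

theorem IsHighest.unique {S : Finset V} {β β' : V} (h : ctx.IsHighest S β)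
    (h' : ctx.IsHighest S β') : β = β' :=
  h'.maximal β h.1 (h.2.2 β' h'.1)

theorem IsHighest.inner_nonneg {S : Finset V} (hS : ctx.IsSubsystem S) {β γ : V}
    (h : ctx.IsHighest S β) (hγ : γ ∈ S) (hγp : γ ∈ ctx.Pos) : 0 ≤ ⟪γ, β⟫ :=
  hS.inner_nonneg_of_maximal h.1 h.maximal h.2.1 hγ hγp

/-- Heisenberg property: `⟨γ, β∨⟩ = 1` if `γ ≠ β` is not orthogonal to the highest root `β`. -/
theorem IsHighest.two_mul_inner {S : Finset V} (hS : ctx.IsSubsystem S) {β γ : V}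
    (h : ctx.IsHighest S β) (hγ : γ ∈ S) (hne : γ ≠ β) (hpos : 0 < ⟪γ, β⟫) :
    2 * ⟪γ, β⟫ = ⟪β, β⟫ := by
  obtain ⟨f, hf⟩ := ctx.exists_height
  have hβ := hS.1 h.1
  obtain ⟨k, hk⟩ := ctx.pairing_int β hβ γ (hS.1 hγ)
  have hr := ctx.reflect_mem β hβ γ (hS.1 hγ)
  rw [hk] at hr
  have pβ := ctx.inner_self_pos hβ
  have hk' : 2 * ⟪γ, β⟫ = k * ⟪β, β⟫ := by
    rw [cartanPairing, div_eq_iff pβ.ne'] at hk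
    exact hk
  have kpos : 0 < k := by
    have : (0 : ℝ) < k := by
      by_contra hc
      nlinarith
    exact_mod_cast this
  rcases eq_or_lt_of_le (show 1 ≤ k by omega) with hk1 | hk1
  · rw [hk', ← hk1]
    simp
  exfalso
  have k2 : (2 : ℝ) ≤ k := by exact_mod_cast hk1
  have h1 := hf _ (h.2.2 _ hγ)
  have h2 := (hf _ (h.2.2 _ (hS.neg (hS.sub_smul hγ h.1 k hr)))).1
  have h3 := (hf _ (ctx.pos_coords _ h.2.1)).1
  simp only [map_sub, map_neg, map_smul, smul_eq_mul] at h1 h2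
  exact hne (sub_eq_zero.1 (h1.2 (by nlinarith))).symm

theorem inner_nonneg_of_mem_closure {T : Set V} {x v : V} (hx : x ∈ AddSubmonoid.closure T)
    (h : ∀ a ∈ T, 0 ≤ ⟪a, v⟫) : 0 ≤ ⟪x, v⟫ := by
  induction hx using AddSubmonoid.closure_induction with
  | mem x hx => exact h x hx
  | zero => simp
  | add x y _ _ h1 h2 =>
    rw [inner_add_left]
    exact add_nonneg h1 h2

/-- Two maximal positive roots of an irreducible component are not orthogonal. -/
theorem IsSubsystem.inner_pos_of_maximal {S : Finset V} {γ₀ : V}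
    (hS : ctx.IsSubsystem (_root_.component S γ₀)) {β β' : V}
    (hβ : β ∈ _root_.component S γ₀) (hβp : β ∈ ctx.Pos)
    (hmax : ∀ x ∈ _root_.component S γ₀, ctx.rootLE β x → x = β)
    (hβ' : β' ∈ _root_.component S γ₀) (hβp' : β' ∈ ctx.Pos)
    (hmax' : ∀ x ∈ _root_.component S γ₀, ctx.rootLE β' x → x = β') : 0 < ⟪β, β'⟫ := by
  obtain ⟨f, hf⟩ := ctx.exists_height
  set C := _root_.component S γ₀ with hC
  set Q := AddSubmonoid.closure {x | x ∈ C ∧ x ∈ ctx.Pos} with hQ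
  have hCQ : ∀ x ∈ C, x ∈ ctx.Pos → x ∈ Q := fun x h1 h2 => AddSubmonoid.subset_closure ⟨h1, h2⟩
  let T : V → Prop := fun a => a ∈ C ∧ a ∈ ctx.Pos ∧ ∃ n : ℕ, n • β - a ∈ Q
  have hTβ : T β := ⟨hβ, hβp, 1, by simp⟩
  have step : ∀ γ δ, T γ → δ ∈ C → δ ∈ ctx.Pos → ⟪γ, δ⟫ ≠ 0 → T δ := by
    by_contra hcon
    push Not at hcon
    let B := C.filter fun δ => δ ∈ ctx.Pos ∧ ¬ T δ ∧ ∃ γ, T γ ∧ ⟪γ, δ⟫ ≠ 0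
    have hB : B.Nonempty := by
      obtain ⟨γ, δ, h1, h2, h3, h4, h5⟩ := hcon
      exact ⟨δ, Finset.mem_filter.2 ⟨h2, h3, h5, γ, h1, h4⟩⟩
    obtain ⟨δ, hδB, hmin⟩ := B.exists_min_image f hB
    obtain ⟨hδ, hδp, hδT, γ, hγ, hγδ⟩ := Finset.mem_filter.1 hδB
    have hle : ∀ a, T a → ⟪a, δ⟫ ≤ 0 := by
      intro a ha
      by_contra! hpos
      have hδ0 := hS.1 hδ
      have ha0 := hS.1 ha.1
      obtain ⟨k, hk⟩ := ctx.pairing_int a ha0 δ hδ0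
      have hr := ctx.reflect_mem a ha0 δ hδ0
      rw [hk] at hr
      have pa := ctx.inner_self_pos ha0
      have hk' : 2 * ⟪a, δ⟫ = k * ⟪a, a⟫ := by
        rw [cartanPairing, div_eq_iff pa.ne', real_inner_comm] at hk
        exact hk
      have kpos : 0 < k := by
        have : (0 : ℝ) < k := by
          by_contra hc
          nlinarith
        exact_mod_cast this
      lift k to ℕ using kpos.le
      simp only [Int.cast_natCast] at hr hk'
      have hrC := hS.sub_smul hδ ha.1 _ hr
      obtain ⟨n, hn⟩ := ha.2.2
      have hkn : (k * n) • β - k • a ∈ Q := by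
        rw [mul_smul, ← smul_sub]
        exact AddSubmonoid.nsmul_mem _ hn k
      rw [Nat.cast_smul_eq_nsmul] at hr hrC
      rcases ctx.pos_or_neg _ hr with hp | hp
      · have hmem : δ - k • a ∈ B := by
          refine Finset.mem_filter.2 ⟨hrC, hp, fun hT => hδT ?_, a, ha, ?_⟩
          · obtain ⟨m, hm⟩ := hT.2.2
            refine ⟨hδ, hδp, k * n + m, ?_⟩
            have := Q.add_mem hkn hm
            rw [add_smul]
            convert this using 1
            abel
          · rw [← Nat.cast_smul_eq_nsmul ℝ, inner_sub_right, inner_smul_right]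
            intro h0
            nlinarith
        have h1 := hmin _ hmem
        have h2 := hf _ (ctx.pos_coords _ ha.2.1)
        have h3 : 0 < f a := lt_of_le_of_ne h2.1
          (fun h => ctx.ne_zero_of_mem ha0 (h2.2 h.symm))
        have h4 : (0 : ℝ) < k := by exact_mod_cast kpos
        rw [← Nat.cast_smul_eq_nsmul ℝ, map_sub, map_smul, smul_eq_mul] at h1
        nlinarith
      · refine hδT ⟨hδ, hδp, k * n, ?_⟩
        have := Q.add_mem hkn (hCQ _ (hS.neg hrC) hp)
        simpa using this
    have hQle : ∀ x ∈ Q, (∃ n : ℕ, n • β - x ∈ Q) → ⟪x, δ⟫ ≤ 0 := by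
      intro x hx
      induction hx using AddSubmonoid.closure_induction with
      | mem x hx => exact fun h => hle x ⟨hx.1, hx.2, h⟩
      | zero => simp
      | add x y hx hy h1 h2 =>
        rintro ⟨n, hn⟩
        rw [inner_add_left]
        refine add_nonpos (h1 ⟨n, ?_⟩) (h2 ⟨n, ?_⟩)
        · convert Q.add_mem hn hy using 1
          abel
        · convert Q.add_mem hn hx using 1
          abel
    obtain ⟨n, hn⟩ := hγ.2.2
    have h1 := hQle _ hn ⟨n, by simpa using hCQ _ hγ.1 hγ.2.1⟩
    have h2 := lt_of_le_of_ne (hle γ hγ) hγδ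
    have h3 := hS.inner_nonneg_of_maximal hβ hmax hβp hδ hδp
    rw [real_inner_comm] at h3
    rw [← Nat.cast_smul_eq_nsmul ℝ, inner_sub_left, real_inner_smul_left] at h1
    have h4 : (0 : ℝ) ≤ n := Nat.cast_nonneg n
    nlinarith
  have hall := component_induction (fun x => T x ∨ T (-x)) hβ (Or.inl hTβ) (by
    intro x hx y hy hxy hT
    rcases ctx.pos_or_neg y (hS.1 hy) with hp | hp
    · left
      rcases hT with hT | hT
      · exact step x y hT hy hp hxy
      · exact step (-x) y hT hy hp (by simpa using hxy)
    · right
      rcases hT with hT | hT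
      · exact step x (-y) hT (hS.neg hy) hp (by simpa using hxy)
      · exact step (-x) (-y) hT (hS.neg hy) hp (by simpa using hxy)) β' hβ'
  rcases hall with hT | hT
  · obtain ⟨n, hn⟩ := hT.2.2
    have h1 := inner_nonneg_of_mem_closure (v := β') hn fun a ha =>
      hS.inner_nonneg_of_maximal hβ' hmax' hβp' ha.1 ha.2
    rw [← Nat.cast_smul_eq_nsmul ℝ, inner_sub_left, real_inner_smul_left] at h1
    have h2 := ctx.inner_self_pos (ctx.pos_subset hβp')
    have h4 : (0 : ℝ) ≤ n := Nat.cast_nonneg n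
    by_contra hc
    nlinarith
  · exact absurd hT.2.1 (ctx.pos_not_neg _ hβp')

/-- Every irreducible component of a root subsystem has a highest root. -/
theorem IsSubsystem.exists_isHighest {S C : Finset V} (hS : ctx.IsSubsystem S)
    (hC : IsComponent S C) : ∃ β, ctx.IsHighest C β := by
  obtain ⟨γ₀, hγ₀, rfl⟩ := hC
  obtain ⟨f, hf⟩ := ctx.exists_height
  have hC := hS.component γ₀
  have hmem : γ₀ ∈ _root_.component S γ₀ := Finset.mem_filter.2 ⟨hγ₀, .refl⟩
  have hexists : ∀ γ ∈ _root_.component S γ₀, ∃ β ∈ _root_.component S γ₀,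
      ctx.rootLE γ β ∧ ∀ x ∈ _root_.component S γ₀, ctx.rootLE β x → x = β := by
    intro γ hγ
    obtain ⟨β, hβ, hβmax⟩ :=
      ((_root_.component S γ₀).filter fun x => ctx.rootLE γ x).exists_max_image f
        ⟨γ, Finset.mem_filter.2 ⟨hγ, by simp [rootLE]⟩⟩
    rw [Finset.mem_filter] at hβ
    refine ⟨β, hβ.1, hβ.2, fun x hx hle => ?_⟩
    have h1 := hβmax x (Finset.mem_filter.2 ⟨hx, by
      have := AddSubmonoid.add_mem _ hle hβ.2
      simpa [rootLE] using this⟩)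
    have h2 := hf _ hle
    rw [map_sub] at h2
    exact sub_eq_zero.1 (h2.2 (by linarith))
  have hpos : ∀ β ∈ _root_.component S γ₀,
      (∀ x ∈ _root_.component S γ₀, ctx.rootLE β x → x = β) → β ∈ ctx.Pos := by
    intro β hβ hmax
    rcases ctx.pos_or_neg β (hC.1 hβ) with hp | hp
    · exact hp
    · have h1 := hmax _ (hC.neg hβ) (by
        have := AddSubmonoid.add_mem _ (ctx.pos_coords _ hp) (ctx.pos_coords _ hp)
        simpa [rootLE, sub_eq_add_neg] using this)
      rwa [h1] at hp
  obtain ⟨β, hβ, -, hmax⟩ := hexists γ₀ hmem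
  have hβp := hpos β hβ hmax
  refine ⟨β, hβ, hβp, fun γ hγ => ?_⟩
  obtain ⟨β', hβ', hle, hmax'⟩ := hexists γ hγ
  have hβp' := hpos β' hβ' hmax'
  suffices β = β' by rwa [this]
  by_contra hne
  have h1 := hC.inner_pos_of_maximal hβ hβp hmax hβ' hβp' hmax'
  have h2 := ctx.sub_mem (hC.1 hβ) (hC.1 hβ') h1 hne
  rcases ctx.pos_or_neg _ h2 with hp | hp
  · exact hne (hmax' β hβ (ctx.pos_coords _ hp))
  · exact hne (hmax β' hβ' (by simpa [rootLE] using ctx.pos_coords _ hp)).symm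

theorem CascadeMem.isSubsystem_isHighest {S : Finset V} {β : V} (h : ctx.CascadeMem S β) :
    ctx.IsSubsystem S ∧ ctx.IsHighest S β := by
  induction h with
  | top =>
    exact ⟨⟨subset_rfl, fun _ _ _ _ _ _ h => h⟩, ctx.pos_subset ctx.theta_mem, ctx.theta_mem,
      ctx.theta_highest⟩
  | step _ hC hβ ih =>
    obtain ⟨γ, _, rfl⟩ := hC
    exact ⟨(ih.1.orthSub _).component γ, hβ⟩

variable (ctx) in
/-- The cascade pairs obtained after exactly `n` steps of the recursive construction. -/
inductive CascadeAt : ℕ → Finset V → V → Prop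
  | top : CascadeAt 0 ctx.Δ ctx.θ
  | step {n : ℕ} {S C : Finset V} {β β' : V} : CascadeAt n S β →
      IsComponent (_root_.orthSub S β) C → ctx.IsHighest C β' → CascadeAt (n + 1) C β'

theorem CascadeMem.exists_cascadeAt {S : Finset V} {β : V} (h : ctx.CascadeMem S β) :
    ∃ n, ctx.CascadeAt n S β := by
  induction h with
  | top => exact ⟨0, .top⟩
  | step _ hC hβ ih =>
    obtain ⟨n, hn⟩ := ih
    exact ⟨n + 1, .step hn hC hβ⟩

theorem _root_.IsComponent.subset {S C : Finset V} (h : IsComponent S C) : C ⊆ S := by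
  obtain ⟨γ, _, rfl⟩ := h
  exact Finset.filter_subset _ _

theorem orthSub_subset (S : Finset V) (β : V) : _root_.orthSub S β ⊆ S :=
  Finset.filter_subset _ _

theorem CascadeAt.exists_ancestor {n : ℕ} {S : Finset V} {β : V} (h : ctx.CascadeAt n S β) :
    ∀ m < n, ∃ S₀ β₀, ctx.CascadeAt m S₀ β₀ ∧ S ⊆ _root_.orthSub S₀ β₀ := by
  induction h with
  | top => exact fun m hm => absurd hm (Nat.not_lt_zero m)
  | @step n S C β β' hS hC hβ ih =>
    intro m hm
    rcases Nat.lt_succ_iff_lt_or_eq.1 hm with hm | rfl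
    · obtain ⟨S₀, β₀, h1, h2⟩ := ih m hm
      exact ⟨S₀, β₀, h1, (IsComponent.subset hC).trans ((orthSub_subset S β).trans h2)⟩
    · exact ⟨S, β, hS, IsComponent.subset hC⟩

theorem CascadeAt.eq_of_inner_ne_zero {n : ℕ} : ∀ {S S' : Finset V} {β β' a b : V},
    ctx.CascadeAt n S β → ctx.CascadeAt n S' β' → a ∈ S → b ∈ S' → ⟪a, b⟫ ≠ 0 →
      S = S' ∧ β = β' := by
  induction n with
  | zero =>
    intro S S' β β' a b h h' _ _ _
    cases h
    cases h'
    exact ⟨rfl, rfl⟩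
  | succ n ih =>
    intro S S' β β' a b h h' ha hb hab
    obtain @⟨-⟩ | @⟨_, S₁, _, β₁, _, h1, hC, hβ⟩ := h
    obtain @⟨-⟩ | @⟨_, S₂, _, β₂, _, h2, hC', hβ'⟩ := h'
    obtain ⟨rfl, rfl⟩ := ih h1 h2 (orthSub_subset _ _ (IsComponent.subset hC ha))
      (orthSub_subset _ _ (IsComponent.subset hC' hb)) hab
    obtain ⟨γ, _, rfl⟩ := hC
    obtain ⟨γ', _, rfl⟩ := hC'
    have := component_eq_of_inner_ne_zero ha hb hab
    rw [← this] at hβ'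
    exact ⟨this, hβ.unique hβ'⟩

theorem CascadeAt.subset_orthSub {m n : ℕ} {S S' : Finset V} {β β' a b : V}
    (h : ctx.CascadeAt m S β) (h' : ctx.CascadeAt n S' β') (hmn : m < n) (ha : a ∈ S)
    (hb : b ∈ S') (hab : ⟪a, b⟫ ≠ 0) : S' ⊆ _root_.orthSub S β := by
  obtain ⟨S₀, β₀, h0, hsub⟩ := h'.exists_ancestor m hmn
  obtain ⟨rfl, rfl⟩ := h.eq_of_inner_ne_zero h0 ha (orthSub_subset _ _ (hsub hb)) hab
  exact hsub

/-- Distinct elements of the cascade are orthogonal. -/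
theorem CascadeMem.inner_eq_zero {S S' : Finset V} {β β' : V} (h : ctx.CascadeMem S β)
    (h' : ctx.CascadeMem S' β') (hne : β ≠ β') : ⟪β, β'⟫ = 0 := by
  by_contra hin
  have hβ := h.isSubsystem_isHighest.2.1
  have hβ' := h'.isSubsystem_isHighest.2.1
  obtain ⟨m, hm⟩ := h.exists_cascadeAt
  obtain ⟨n, hn⟩ := h'.exists_cascadeAt
  rcases lt_trichotomy m n with hmn | rfl | hmn
  · have := Finset.mem_filter.1 (hm.subset_orthSub hn hmn hβ hβ' hin hβ')
    exact hin (by rw [real_inner_comm]; exact this.2)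
  · exact hne (hm.eq_of_inner_ne_zero hn hβ hβ' hin).2
  · exact hin (Finset.mem_filter.1 (hn.subset_orthSub hm hmn hβ' hβ
      (by rwa [real_inner_comm]) hβ)).2

/-- The Heisenberg subsets attached to distinct cascade elements are disjoint. -/
theorem CascadeMem.eq_of_mem_heis {S S' : Finset V} {β β' γ : V} (h : ctx.CascadeMem S β)
    (h' : ctx.CascadeMem S' β') (hγ : γ ∈ ctx.heis S β) (hγ' : γ ∈ ctx.heis S' β') :
    β = β' := by
  rw [heis, Finset.mem_filter] at hγ hγ'
  have hself := (ctx.inner_self_pos (ctx.pos_subset hγ.2.1)).ne'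
  obtain ⟨m, hm⟩ := h.exists_cascadeAt
  obtain ⟨n, hn⟩ := h'.exists_cascadeAt
  rcases lt_trichotomy m n with hmn | rfl | hmn
  · have := Finset.mem_filter.1 (hm.subset_orthSub hn hmn hγ.1 hγ'.1 hself hγ'.1)
    exact absurd this.2 hγ.2.2.ne'
  · exact (hm.eq_of_inner_ne_zero hn hγ.1 hγ'.1 hself).2
  · have := Finset.mem_filter.1 (hn.subset_orthSub hm hmn hγ'.1 hγ.1 hself hγ.1)
    exact absurd this.2 hγ'.2.2.ne'

theorem CascadeMem.exists_mem_heis_of_mem {γ : V} (hγ : γ ∈ ctx.Pos) :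
    ∀ (n : ℕ) {S : Finset V} {β : V}, S.card = n → ctx.CascadeMem S β → γ ∈ S →
      ∃ S' β', ctx.CascadeMem S' β' ∧ γ ∈ ctx.heis S' β' := by
  intro n
  induction n using Nat.strong_induction_on with
  | _ n ih =>
    rintro S β rfl h hγS
    obtain ⟨hS, hβ⟩ := h.isSubsystem_isHighest
    rcases (hβ.inner_nonneg hS hγS hγ).lt_or_eq with hpos | hz
    · exact ⟨S, β, h, Finset.mem_filter.2 ⟨hγS, hγ, hpos⟩⟩
    · have ho : γ ∈ _root_.orthSub S β := Finset.mem_filter.2 ⟨hγS, hz.symm⟩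
      have hC : IsComponent (_root_.orthSub S β) (_root_.component (_root_.orthSub S β) γ) :=
        ⟨γ, ho, rfl⟩
      obtain ⟨β', hβ'⟩ := (hS.orthSub β).exists_isHighest hC
      refine ih _ (Finset.card_lt_card
        ⟨(IsComponent.subset hC).trans (orthSub_subset S β), fun hsub => ?_⟩) rfl
        (.step h hC hβ') (Finset.mem_filter.2 ⟨ho, .refl⟩)
      have := (Finset.mem_filter.1 (IsComponent.subset hC (hsub hβ.1))).2
      exact (ctx.inner_self_pos (hS.1 hβ.1)).ne' this

/-- The Heisenberg subsets cover the positive roots. -/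
theorem exists_mem_heis {γ : V} (hγ : γ ∈ ctx.Pos) :
    ∃ S β, ctx.CascadeMem S β ∧ γ ∈ ctx.heis S β :=
  CascadeMem.exists_mem_heis_of_mem hγ _ rfl .top (ctx.pos_subset hγ)

/-- The root subsystems of the cascade are closed under taking positive summands. -/
theorem CascadeMem.mem_of_add_mem {S : Finset V} {β : V} (h : ctx.CascadeMem S β) :
    ∀ γ ∈ ctx.Pos, ∀ δ ∈ ctx.Pos, γ + δ ∈ S → γ ∈ S ∧ δ ∈ S := by
  induction h with
  | top => exact fun γ hγ δ hδ _ => ⟨ctx.pos_subset hγ, ctx.pos_subset hδ⟩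
  | @step S C β β' hS hC hβ' ih =>
    intro γ hγ δ hδ hx
    obtain ⟨hsub, hβ⟩ := hS.isSubsystem_isHighest
    have hxo := Finset.mem_filter.1 (IsComponent.subset hC hx)
    obtain ⟨h1, h2⟩ := ih γ hγ δ hδ hxo.1
    have i1 := hβ.inner_nonneg hsub h1 hγ
    have i2 := hβ.inner_nonneg hsub h2 hδ
    have i3 := hxo.2
    rw [inner_add_left] at i3
    have o1 : γ ∈ _root_.orthSub S β := Finset.mem_filter.2 ⟨h1, by linarith⟩
    have o2 : δ ∈ _root_.orthSub S β := Finset.mem_filter.2 ⟨h2, by linarith⟩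
    obtain ⟨γ₀, _, rfl⟩ := hC
    have hCs := (hsub.orthSub β).component γ₀
    have hpos := ctx.inner_self_pos (hCs.1 hx)
    by_cases hz : ⟪γ + δ, γ⟫ = 0
    · have hz' : ⟪γ + δ, δ⟫ ≠ 0 := fun h0 => by
        rw [inner_add_right, hz, h0] at hpos
        simp at hpos
      have m2 := mem_component_of_inner_ne_zero hx o2 hz'
      have m1 := hCs.sub hx m2 (by simpa using ctx.pos_subset hγ)
      exact ⟨by simpa using m1, m2⟩
    · have m1 := mem_component_of_inner_ne_zero hx o1 hz
      have m2 := hCs.sub hx m1 (by simpa using ctx.pos_subset hδ)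
      exact ⟨m1, by simpa using m2⟩

/-- If a cascade element is a sum of two positive roots, then both lie in its Heisenberg
subset. -/
theorem CascadeMem.mem_heis_of_add_eq {S : Finset V} {β γ δ : V} (h : ctx.CascadeMem S β)
    (hγ : γ ∈ ctx.Pos) (hδ : δ ∈ ctx.Pos) (hadd : γ + δ = β) : δ ∈ ctx.heis S β := by
  obtain ⟨hS, hβ⟩ := h.isSubsystem_isHighest
  obtain ⟨h1, h2⟩ := h.mem_of_add_mem γ hγ δ hδ (hadd ▸ hβ.1)
  refine Finset.mem_filter.2 ⟨h2, hδ, (hβ.inner_nonneg hS h2 hδ).lt_of_ne fun hz => ?_⟩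
  have e : ⟪β, β⟫ = ⟪γ, β⟫ := by
    conv_lhs => rw [← hadd, inner_add_left, hadd, ← hz, add_zero]
  have hp := ctx.inner_self_pos (hS.1 hβ.1)
  have := hβ.two_mul_inner hS h1
    (fun he => ctx.ne_zero_of_mem (ctx.pos_subset hδ) (by rw [← he] at hadd; simpa using hadd))
    (e ▸ hp)
  linarith

/-- The involution `δ ↦ β - δ` of the punctured Heisenberg subset. -/
theorem CascadeMem.sub_mem_pos {S : Finset V} {β δ : V} (h : ctx.CascadeMem S β)
    (hδ : δ ∈ ctx.heis S β) (hne : δ ≠ β) : β - δ ∈ ctx.Pos := by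
  obtain ⟨hS, hβ⟩ := h.isSubsystem_isHighest
  obtain ⟨h1, h2, h3⟩ := Finset.mem_filter.1 hδ
  exact ctx.mem_pos_of_cone
    (ctx.sub_mem (hS.1 hβ.1) (hS.1 h1) (by rwa [real_inner_comm]) hne.symm) (hβ.2.2 _ h1)

theorem CascadeMem.self_mem_heis {S : Finset V} {β : V} (h : ctx.CascadeMem S β) :
    β ∈ ctx.heis S β := by
  obtain ⟨hS, hβ⟩ := h.isSubsystem_isHighest
  exact Finset.mem_filter.2 ⟨hβ.1, hβ.2.1, ctx.inner_self_pos (hS.1 hβ.1)⟩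

theorem IsCascade.subset_pos {K : Finset V} (hK : ctx.IsCascade K) : K ⊆ ctx.Pos := by
  intro β hβ
  obtain ⟨S, h⟩ := (hK β).1 hβ
  exact h.isSubsystem_isHighest.2.2.1

theorem IsCascade.inner_eq_zero {K : Finset V} (hK : ctx.IsCascade K) {β β' : V} (hβ : β ∈ K)
    (hβ' : β' ∈ K) (hne : β ≠ β') : ⟪β, β'⟫ = 0 := by
  obtain ⟨S, h⟩ := (hK β).1 hβ
  obtain ⟨S', h'⟩ := (hK β').1 hβ'
  exact h.inner_eq_zero h' hne

theorem IsCascade.inner_cascElt {K : Finset V} (hK : ctx.IsCascade K) {β : V} (hβ : β ∈ K) :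
    ⟪β, cascElt K⟫ = 1 := by
  rw [cascElt, inner_sum, Finset.sum_eq_single_of_mem β hβ]
  · rw [inner_smul_right, inv_mul_cancel₀]
    exact (ctx.inner_self_pos (ctx.pos_subset (hK.subset_pos hβ))).ne'
  · intro b hb hne
    rw [inner_smul_right, hK.inner_eq_zero hβ hb hne.symm, mul_zero]

/-- For each positive root `δ` outside the cascade there is a unique positive root `γ` such
that `γ + δ` belongs to the cascade. -/
theorem IsCascade.exists_partner {K : Finset V} (hK : ctx.IsCascade K) {δ : V}
    (hδ : δ ∈ ctx.Pos) (hδK : δ ∉ K) :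
    ∃ γ ∈ ctx.Pos, γ + δ ∈ K ∧ ∀ γ' ∈ ctx.Pos, γ' + δ ∈ K → γ' = γ := by
  obtain ⟨S, β, h, hmem⟩ := exists_mem_heis hδ
  have hβ : β ∈ K := (hK β).2 ⟨S, h⟩
  refine ⟨β - δ, h.sub_mem_pos hmem fun he => hδK (he ▸ hβ), by simpa using hβ, ?_⟩
  intro γ' hγ' hadd
  obtain ⟨S', h'⟩ := (hK _).1 hadd
  rw [h.eq_of_mem_heis h' hmem (h'.mem_heis_of_add_eq hγ' hδ rfl)]
  simp

theorem IsCascade.add_notMem {K : Finset V} (hK : ctx.IsCascade K) {γ β : V}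
    (hγ : γ ∈ ctx.Pos) (hβ : β ∈ K) : γ + β ∉ K := by
  intro hadd
  obtain ⟨S, h⟩ := (hK β).1 hβ
  obtain ⟨S', h'⟩ := (hK _).1 hadd
  have := h.eq_of_mem_heis h' h.self_mem_heis
    (h'.mem_heis_of_add_eq hγ (hK.subset_pos hβ) rfl)
  exact ctx.ne_zero_of_mem (ctx.pos_subset hγ) (by simpa using this)

end RootSystemCtx

end CascadeCombinatorics

namespace LieRootData

variable {V : Type*} [NormedAddCommGroup V] [InnerProductSpace ℝ V] {ctx : RootSystemCtx V}
  {g : Type*} [LieRing g] [LieAlgebra ℂ g] (d : LieRootData ctx g)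

theorem bracket_coh_coh (v w : V) : ⁅d.coh v, d.coh w⁆ = 0 :=
  d.t_abelian _ (d.coh_mem v) _ (d.coh_mem w)

theorem span_eq_top :
    Submodule.span ℂ (Set.range d.coh ∪ d.e '' (ctx.Δ : Set V)) = ⊤ := by
  rw [Submodule.span_union, ← d.t_span, ← d.span_top]

theorem killingForm_e_coh {δ : V} (hδ : δ ∈ ctx.Δ) (v : V) :
    killingForm ℂ g (d.e δ) (d.coh v) = 0 := by
  have h := LieModule.traceForm_apply_lie_apply ℂ g g (d.e δ) (d.coh δ) (d.coh v)
  rw [d.bracket_coh_coh, ← lie_skew, d.bracket_coh_e δ δ hδ] at h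
  simpa [ctx.ne_zero_of_mem hδ] using h

theorem killingForm_e_e {γ δ : V} (hγ : γ ∈ ctx.Δ) (hδ : δ ∈ ctx.Δ) (hne : γ + δ ≠ 0) :
    killingForm ℂ g (d.e γ) (d.e δ) = 0 := by
  have h := LieModule.traceForm_apply_lie_apply ℂ g g (d.e γ) (d.coh (γ + δ)) (d.e δ)
  rw [← lie_skew, d.bracket_coh_e _ γ hγ, d.bracket_coh_e _ δ hδ] at h
  simp only [map_neg, map_smul, LinearMap.neg_apply, LinearMap.smul_apply, smul_eq_mul] at h
  have h2 : ((⟪γ + δ, γ + δ⟫ : ℝ) : ℂ) * killingForm ℂ g (d.e γ) (d.e δ) = 0 := by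
    rw [inner_add_left]
    push_cast
    linear_combination -h
  rcases mul_eq_zero.1 h2 with h3 | h3
  · exact absurd (inner_self_eq_zero.1 (Complex.ofReal_eq_zero.1 h3)) hne
  · exact h3

theorem killingForm_sum_coh {K : Finset V} (hK : K ⊆ ctx.Pos) (v : V) :
    killingForm ℂ g (∑ β ∈ K, d.e (-β)) (d.coh v) = 0 := by
  rw [map_sum, LinearMap.sum_apply]
  exact Finset.sum_eq_zero fun β hβ =>
    d.killingForm_e_coh (ctx.neg_mem β (ctx.pos_subset (hK hβ))) v

theorem killingForm_sum_e_of_notMem {K : Finset V} (hK : K ⊆ ctx.Pos) {γ : V} (hγ : γ ∈ ctx.Δ)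
    (h : γ ∉ K) : killingForm ℂ g (∑ β ∈ K, d.e (-β)) (d.e γ) = 0 := by
  rw [map_sum, LinearMap.sum_apply]
  refine Finset.sum_eq_zero fun β hβ =>
    d.killingForm_e_e (ctx.neg_mem β (ctx.pos_subset (hK hβ))) hγ fun h0 => h ?_
  rwa [← neg_add_eq_zero.1 h0]

variable [FiniteDimensional ℂ g]

/-- Roots are not isotropic for the Killing form. -/
theorem killingForm_coh_self_ne_zero {γ : V} (hγ : γ ∈ ctx.Δ) :
    killingForm ℂ g (d.coh γ) (d.coh γ) ≠ 0 := by
  let bt := Module.finBasis ℂ d.t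
  let v : Fin (Module.finrank ℂ d.t) ⊕ ctx.Δ → g := Sum.elim (fun i => (bt i : g)) fun δ => d.e δ
  let μ : Fin (Module.finrank ℂ d.t) ⊕ ctx.Δ → ℝ := Sum.elim (fun _ => 0) fun δ => ⟪(δ : V), γ⟫ ^ 2
  have hspan : ⊤ ≤ Submodule.span ℂ (Set.range v) := by
    rw [d.span_top, Set.Sum.elim_range, Submodule.span_union]
    refine sup_le_sup ?_ (Submodule.span_mono ?_)
    · intro x hx
      have h1 := Submodule.mem_map_of_mem (f := d.t.toSubmodule.subtype)
        (bt.mem_span ⟨x, hx⟩)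
      rw [Submodule.map_span, ← Set.range_comp] at h1
      exact h1
    · rintro _ ⟨δ, hδ, rfl⟩
      exact ⟨⟨δ, hδ⟩, rfl⟩
  let b := basisOfTopLeSpanOfCardEqFinrank v hspan (by simp [d.dim_eq])
  have hb : ∀ i, b i = v i := fun i => by simp [b]
  have hv : ∀ i, (LieAlgebra.ad ℂ g (d.coh γ) ∘ₗ LieAlgebra.ad ℂ g (d.coh γ)) (b i) =
      (μ i : ℂ) • b i := by
    intro i
    rw [hb]
    rcases i with i | δ
    · simp [v, μ, d.t_abelian _ (d.coh_mem γ) _ (bt i).2]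
    · simp only [v, μ, Sum.elim_inr, LinearMap.comp_apply, LieAlgebra.ad_apply,
        d.bracket_coh_e γ δ δ.2, lie_smul, smul_smul, sq, Complex.ofReal_mul]
  rw [killingForm_apply_apply, LinearMap.trace_eq_matrix_trace ℂ b, Matrix.trace]
  have hd : ∀ i, (LinearMap.toMatrix b b
      (LieAlgebra.ad ℂ g (d.coh γ) ∘ₗ LieAlgebra.ad ℂ g (d.coh γ))).diag i = (μ i : ℂ) := by
    intro i
    rw [Matrix.diag_apply, LinearMap.toMatrix_apply, hv, map_smul, Finsupp.smul_apply,
      Module.Basis.repr_self, Finsupp.single_eq_same, smul_eq_mul, mul_one]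
  rw [Finset.sum_congr rfl fun i _ => hd i, ← Complex.ofReal_sum, Complex.ofReal_ne_zero]
  refine (Finset.sum_pos' (fun i _ => ?_) ⟨Sum.inr ⟨γ, hγ⟩, Finset.mem_univ _, ?_⟩).ne'
  · rcases i with i | δ
    · exact le_rfl
    · exact sq_nonneg _
  · exact pow_pos (ctx.inner_self_pos hγ) 2

theorem killingForm_e_neg_ne_zero {γ : V} (hγ : γ ∈ ctx.Δ) :
    killingForm ℂ g (d.e (-γ)) (d.e γ) ≠ 0 := by
  intro h0
  obtain ⟨c, hc, hb⟩ := d.bracket_e_e_neg γ hγ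
  have h := LieModule.traceForm_apply_lie_apply ℂ g g (d.e γ) (d.e (-γ)) (d.coh γ)
  rw [hb, ← lie_skew (d.e (-γ)), d.bracket_coh_e _ _ (ctx.neg_mem γ hγ)] at h
  have h0' : LieModule.traceForm ℂ g g (d.e γ) (d.e (-γ)) = 0 := by
    rw [LieModule.traceForm_comm]
    exact h0
  simp only [map_neg, map_smul, LinearMap.smul_apply, smul_eq_mul, h0', mul_zero, neg_zero] at h
  exact (mul_ne_zero hc (d.killingForm_coh_self_ne_zero hγ)) h

theorem killingForm_sum_e_ne_zero {K : Finset V} (hK : K ⊆ ctx.Pos) {γ : V} (h : γ ∈ K) :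
    killingForm ℂ g (∑ β ∈ K, d.e (-β)) (d.e γ) ≠ 0 := by
  have hγ := ctx.pos_subset (hK h)
  rw [map_sum, LinearMap.sum_apply, Finset.sum_eq_single_of_mem γ h]
  · exact d.killingForm_e_neg_ne_zero hγ
  · intro β hβ hne
    exact d.killingForm_e_e (ctx.neg_mem β (ctx.pos_subset (hK hβ))) hγ
      fun h0 => hne (neg_add_eq_zero.1 h0)

end LieRootData

namespace LieRootData

variable {V : Type*} [NormedAddCommGroup V] [InnerProductSpace ℝ V] {ctx : RootSystemCtx V}
  {g : Type*} [LieRing g] [LieAlgebra ℂ g] (d : LieRootData ctx g) {K : Finset V}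

/-- The Frobenius envelope `b_K = t_K ⊕ u⁺`, as a span of weight vectors. -/
def envelope (K : Finset V) : Submodule ℂ g :=
  Submodule.span ℂ (d.coh '' (K : Set V) ∪ d.e '' (ctx.Pos : Set V))

theorem coh_mem_envelope {β : V} (hβ : β ∈ K) : d.coh β ∈ d.envelope K :=
  Submodule.subset_span (Or.inl ⟨β, hβ, rfl⟩)

theorem e_mem_envelope {γ : V} (hγ : γ ∈ ctx.Pos) : d.e γ ∈ d.envelope K :=
  Submodule.subset_span (Or.inr ⟨γ, hγ, rfl⟩)

theorem exists_coeff_of_mem_envelope {x : g} (hx : x ∈ d.envelope K) :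
    ∃ c a : V → ℂ, x = ∑ β ∈ K, c β • d.coh β + ∑ γ ∈ ctx.Pos, a γ • d.e γ := by
  rw [envelope, Submodule.span_union, Submodule.mem_sup] at hx
  obtain ⟨y, hy, z, hz, rfl⟩ := hx
  rw [Submodule.mem_span_image_finset_iff_exists_fun'] at hy hz
  obtain ⟨c, rfl⟩ := hy
  obtain ⟨a, rfl⟩ := hz
  exact ⟨c, a, rfl⟩

/-- `ξ` behaves as the Killing pairing with `∑ β ∈ K, e (-β)`. -/
structure IsCascadeForm (K : Finset V) (ξ : g →ₗ[ℂ] ℂ) : Prop where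
  coh : ∀ v, ξ (d.coh v) = 0
  notMem : ∀ γ ∈ ctx.Δ, γ ∉ K → ξ (d.e γ) = 0
  mem : ∀ γ ∈ K, ξ (d.e γ) ≠ 0

variable {d} {ξ : g →ₗ[ℂ] ℂ}

theorem IsCascadeForm.lie_cascElt (hξ : d.IsCascadeForm K ξ) (hK : ctx.IsCascade K) (z : g) :
    ξ ⁅d.coh (cascElt K), z⁆ = ξ z := by
  have h : ξ ∘ₗ LieAlgebra.ad ℂ g (d.coh (cascElt K)) = ξ := by
    refine LinearMap.ext_on d.span_eq_top ?_
    rintro _ (⟨v, rfl⟩ | ⟨γ, hγ, rfl⟩)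
    · simp [d.bracket_coh_coh, hξ.coh]
    · rw [LinearMap.comp_apply, LieAlgebra.ad_apply, d.bracket_coh_e _ γ hγ, map_smul]
      by_cases hγK : γ ∈ K
      · rw [hK.inner_cascElt hγK]
        simp
      · rw [hξ.notMem γ hγ hγK, smul_zero]
  exact LinearMap.congr_fun h z

theorem IsCascadeForm.lie_e_e_of_notMem (hξ : d.IsCascadeForm K ξ) {γ δ : V}
    (hγ : γ ∈ ctx.Pos) (hδ : δ ∈ ctx.Pos) (h : γ + δ ∉ K) : ξ ⁅d.e γ, d.e δ⁆ = 0 := by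
  by_cases hΔ : γ + δ ∈ ctx.Δ
  · obtain ⟨c, _, hb⟩ := d.bracket_e_e_root γ (ctx.pos_subset hγ) δ (ctx.pos_subset hδ) hΔ
    rw [hb, map_smul, hξ.notMem _ hΔ h, smul_zero]
  · rw [d.bracket_e_e_zero γ (ctx.pos_subset hγ) δ (ctx.pos_subset hδ) hΔ, map_zero]
    intro h0
    rw [add_eq_zero_iff_eq_neg'] at h0
    exact ctx.pos_not_neg γ hγ (h0 ▸ hδ)

theorem IsCascadeForm.lie_e_e_of_mem (hξ : d.IsCascadeForm K ξ) (hK : K ⊆ ctx.Pos) {γ δ : V}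
    (hγ : γ ∈ ctx.Pos) (hδ : δ ∈ ctx.Pos) (h : γ + δ ∈ K) : ξ ⁅d.e γ, d.e δ⁆ ≠ 0 := by
  obtain ⟨c, hc, hb⟩ := d.bracket_e_e_root γ (ctx.pos_subset hγ) δ (ctx.pos_subset hδ)
    (ctx.pos_subset (hK h))
  rw [hb, map_smul]
  exact smul_ne_zero hc (hξ.mem _ h)

/-- The stabiliser of a cascade form in the Frobenius envelope is zero. -/
theorem IsCascadeForm.eq_zero_of_forall_lie (hξ : d.IsCascadeForm K ξ) (hK : ctx.IsCascade K)
    {x : g} (hx : x ∈ d.envelope K) (h : ∀ y ∈ d.envelope K, ξ ⁅x, y⁆ = 0) : x = 0 := by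
  have hKp := hK.subset_pos
  obtain ⟨c, a, rfl⟩ := d.exists_coeff_of_mem_envelope hx
  have he : ∀ δ ∈ ctx.Pos, (∑ β ∈ K, c β * ⟪δ, β⟫) * ξ (d.e δ) +
      ∑ γ ∈ ctx.Pos, a γ * ξ ⁅d.e γ, d.e δ⁆ = 0 := by
    intro δ hδ
    rw [← h _ (d.e_mem_envelope hδ), add_lie, sum_lie, sum_lie, map_add, map_sum, map_sum,
      Finset.sum_mul]
    congr 1
    · refine Finset.sum_congr rfl fun β _ => ?_
      rw [smul_lie, d.bracket_coh_e β δ (ctx.pos_subset hδ), map_smul, map_smul, smul_eq_mul,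
        smul_eq_mul, mul_assoc]
    · refine Finset.sum_congr rfl fun γ _ => ?_
      rw [smul_lie, map_smul, smul_eq_mul]
  have hout : ∀ γ ∈ ctx.Pos, γ ∉ K → a γ = 0 := by
    intro γ hγ hγK
    obtain ⟨δ, hδ, hadd, -⟩ := hK.exists_partner hγ hγK
    rw [add_comm] at hadd
    have hδK : δ ∉ K := fun hδK => hK.add_notMem hγ hδK hadd
    obtain ⟨γ₁, hγ₁, -, huniq⟩ := hK.exists_partner hδ hδK
    have h1 := he δ hδ
    rw [hξ.notMem δ (ctx.pos_subset hδ) hδK, mul_zero, zero_add,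
      Finset.sum_eq_single_of_mem γ hγ] at h1
    · exact (mul_eq_zero.1 h1).resolve_right (hξ.lie_e_e_of_mem hKp hγ hδ hadd)
    · intro γ' hγ' hne
      rw [hξ.lie_e_e_of_notMem hγ' hδ, mul_zero]
      exact fun hmem => hne ((huniq γ' hγ' hmem).trans (huniq γ hγ hadd).symm)
  have hc : ∀ β ∈ K, c β = 0 := by
    intro β hβ
    have h1 := he β (hKp hβ)
    rw [Finset.sum_eq_zero (s := ctx.Pos) fun γ hγ => by
      rw [hξ.lie_e_e_of_notMem hγ (hKp hβ) (hK.add_notMem hγ hβ), mul_zero], add_zero,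
      Finset.sum_eq_single_of_mem β hβ fun b hb hne => by
        rw [hK.inner_eq_zero hβ hb hne.symm, Complex.ofReal_zero, mul_zero]] at h1
    have h2 := (mul_eq_zero.1 h1).resolve_right (hξ.mem β hβ)
    refine (mul_eq_zero.1 h2).resolve_right (Complex.ofReal_ne_zero.2 ?_)
    exact (ctx.inner_self_pos (ctx.pos_subset (hKp hβ))).ne'
  have hin : ∀ β ∈ K, a β = 0 := by
    intro β hβ
    have h1 := h _ (d.coh_mem_envelope hβ)
    rw [Finset.sum_eq_zero fun b hb => by rw [hc b hb, zero_smul], zero_add, sum_lie, map_sum,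
      Finset.sum_eq_single_of_mem β (hKp hβ)] at h1
    · rw [smul_lie, ← lie_skew, d.bracket_coh_e β β (ctx.pos_subset (hKp hβ)), map_smul, map_neg,
        map_smul, smul_eq_mul, smul_eq_mul] at h1
      refine (mul_eq_zero.1 h1).resolve_right (neg_ne_zero.2 (mul_ne_zero ?_ (hξ.mem β hβ)))
      exact Complex.ofReal_ne_zero.2 (ctx.inner_self_pos (ctx.pos_subset (hKp hβ))).ne'
    · intro γ hγ hne
      rw [smul_lie, ← lie_skew, d.bracket_coh_e β γ (ctx.pos_subset hγ), map_smul, map_neg,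
        map_smul]
      by_cases hγK : γ ∈ K
      · rw [hK.inner_eq_zero hγK hβ hne]
        simp
      · rw [hout γ hγ hγK, zero_smul]
  rw [Finset.sum_eq_zero fun b hb => by rw [hc b hb, zero_smul], zero_add]
  refine Finset.sum_eq_zero fun γ hγ => ?_
  by_cases hγK : γ ∈ K
  · rw [hin γ hγK, zero_smul]
  · rw [hout γ hγ hγK, zero_smul]

variable [FiniteDimensional ℂ g]

theorem IsCascadeForm.finrank_eigenspace_le (hξ : d.IsCascadeForm K ξ) (hK : ctx.IsCascade K)
    (c : ℂ) :
    Module.finrank ℂ ↥(d.envelope K ⊓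
        Module.End.eigenspace (LieAlgebra.ad ℂ g (d.coh (cascElt K))) c) ≤
      Module.finrank ℂ ↥(d.envelope K ⊓
        Module.End.eigenspace (LieAlgebra.ad ℂ g (d.coh (cascElt K))) (1 - c)) := by
  set h := d.coh (cascElt K) with hh
  set E := d.envelope K ⊓ Module.End.eigenspace (LieAlgebra.ad ℂ g h) c
  set F := d.envelope K ⊓ Module.End.eigenspace (LieAlgebra.ad ℂ g h) (1 - c)
  let B : g →ₗ[ℂ] g →ₗ[ℂ] ℂ := (LieAlgebra.ad ℂ g : g →ₗ[ℂ] Module.End ℂ g).compr₂ ξ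
  have hB : ∀ x y, B x y = ξ ⁅x, y⁆ := fun x y => rfl
  have hinj : Function.Injective (B.domRestrict₁₂ E F) := by
    rw [← LinearMap.ker_eq_bot, LinearMap.ker_eq_bot']
    rintro ⟨x, hx⟩ hzero
    have hzero' : ∀ y ∈ F, ξ ⁅x, y⁆ = 0 := fun y hy => LinearMap.congr_fun hzero ⟨y, hy⟩
    have hxe : ⁅h, x⁆ = c • x := Module.End.mem_eigenspace_iff.1 hx.2
    have key : ∀ (y : g) (r : ℂ), y ∈ d.envelope K → ⁅h, y⁆ = r • y → ξ ⁅x, y⁆ = 0 := by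
      intro y r hy hr
      by_cases hrc : r = 1 - c
      · exact hzero' y ⟨hy, Module.End.mem_eigenspace_iff.2 (hrc ▸ hr)⟩
      · have h1 := hξ.lie_cascElt hK ⁅x, y⁆
        rw [← hh, leibniz_lie, hxe, hr, smul_lie, lie_smul, map_add, map_smul, map_smul,
          smul_eq_mul, smul_eq_mul] at h1
        have h2 : (c + r - 1) * ξ ⁅x, y⁆ = 0 := by linear_combination h1
        refine (mul_eq_zero.1 h2).resolve_left fun h3 => hrc ?_
        linear_combination h3
    refine Subtype.ext (hξ.eq_zero_of_forall_lie hK hx.1 fun y hy => ?_)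
    have hle : d.envelope K ≤ LinearMap.ker (B x) := by
      rw [envelope, Submodule.span_le]
      rintro _ (⟨β, hβ, rfl⟩ | ⟨γ, hγ, rfl⟩)
      · exact key _ 0 (d.coh_mem_envelope hβ) (by rw [hh, d.bracket_coh_coh, zero_smul])
      · exact key _ _ (d.e_mem_envelope hγ) (d.bracket_coh_e _ γ (ctx.pos_subset hγ))
    exact hle hy
  calc Module.finrank ℂ E ≤ Module.finrank ℂ (Module.Dual ℂ F) :=
        LinearMap.finrank_le_finrank_of_injective hinj
    _ = Module.finrank ℂ F := Subspace.dual_finrank_eq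

end LieRootData

/-- The cascade element `x_K` is the Ooms element of the Frobenius envelope
`b_K = t_K ⊕ u⁺` associated with the regular linear form `ξ_K = κ(Σ_{β ∈ K} e_{-β}, ·)`;
consequently the spectrum of `ad x_K` on `b_K` is symmetric with respect to `1/2`. -/
theorem casc_is_ooms_element {V : Type*} [NormedAddCommGroup V] [InnerProductSpace ℝ V]
    [FiniteDimensional ℝ V] (ctx : RootSystemCtx V)
    {g : Type*} [LieRing g] [LieAlgebra ℂ g] [FiniteDimensional ℂ g]
    (d : LieRootData ctx g)
    (K : Finset V) (hK : ctx.IsCascade K) :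
    ∀ tK bK : Submodule ℂ g,
      tK = Submodule.span ℂ (d.coh '' (K : Set V)) →
      bK = tK ⊔ Submodule.span ℂ (d.e '' (ctx.Pos : Set V)) →
      ∀ ξ : g →ₗ[ℂ] ℂ, ξ = killingForm ℂ g (∑ β ∈ K, d.e (-β)) →
      -- ξ_K is a regular element of b_K* : its stabiliser in b_K is zero
      (∀ x ∈ bK, (∀ y ∈ bK, ξ ⁅x, y⁆ = 0) → x = 0) ∧
      -- (ad* x_K) ξ_K = -ξ_K, i.e. x_K is the Ooms element associated with ξ_K
      (∀ y ∈ bK, ξ ⁅d.coh (cascElt K), y⁆ = ξ y) ∧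
      -- the multiset of eigenvalues of ad x_K on b_K is symmetric w.r.t. 1/2
      (∀ c : ℂ,
        Module.finrank ℂ
          ↥(bK ⊓ Module.End.eigenspace (LieAlgebra.ad ℂ g (d.coh (cascElt K))) c) =
        Module.finrank ℂ
          ↥(bK ⊓ Module.End.eigenspace (LieAlgebra.ad ℂ g (d.coh (cascElt K))) (1 - c))) := by
  rintro tK bK rfl hbK ξ rfl
  rw [← Submodule.span_union] at hbK
  subst hbK
  have hKp := hK.subset_pos
  have hξ : d.IsCascadeForm K (killingForm ℂ g (∑ β ∈ K, d.e (-β))) :=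
    ⟨d.killingForm_sum_coh hKp, fun _ => d.killingForm_sum_e_of_notMem hKp,
      fun _ => d.killingForm_sum_e_ne_zero hKp⟩
  refine ⟨fun x hx h => hξ.eq_zero_of_forall_lie hK hx h, fun y _ => hξ.lie_cascElt hK y,
    fun c => le_antisymm (hξ.finrank_eigenspace_le hK c) ?_⟩
  have h := hξ.finrank_eigenspace_le hK (1 - c)
  rw [sub_sub_cancel] at h
  exact h
end

section
/- Let z ∈ t_Q satisfy γ(z) ∈ {-1, 0, 1, 2} for all γ ∈ Δ⁺, and let w_z ∈ W be the unique element with inversion set N(w_z) = Δ⁺_z(1) ∪ Δ⁺_z(2). Then w_z(z) is anti-dominant, i.e., w_z(z) ∈ -C where C is the dominant Weyl chamber; moreover, w_z is the unique element of minimal length in W taking z into -C. -/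
open scoped RealInnerProductSpace

attribute [local instance] Classical.propDecidable

namespace RootSystemCtx

variable {V : Type*} [NormedAddCommGroup V] [InnerProductSpace ℝ V] {ctx : RootSystemCtx V}

section Positivity

/-- Linear functionals can be prescribed arbitrarily on the simple roots. -/
lemma exists_functional (ctx : RootSystemCtx V) (g : V → ℝ) :
    ∃ f : V →ₗ[ℝ] ℝ, ∀ α ∈ ctx.base, f α = g α := by
  obtain ⟨f, hf⟩ := LinearMap.exists_extend
    ((Module.Basis.span ctx.base_indep).constr ℝ fun i => g i)
  refine ⟨f, fun α hα => ?_⟩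
  have h1 := (Module.Basis.span ctx.base_indep).constr_basis ℝ (fun i => g i) ⟨α, hα⟩
  rw [← hf] at h1
  simpa [Module.Basis.span_apply] using h1

lemma ne_zero_of_mem_pos {γ : V} (hγ : γ ∈ ctx.Pos) : γ ≠ 0 :=
  fun h => ctx.zero_not_mem (h ▸ ctx.pos_subset hγ)

/-- There is a linear functional which is positive on all positive roots. -/
lemma exists_height_s10 (ctx : RootSystemCtx V) :
    ∃ h : V →ₗ[ℝ] ℝ, ∀ γ ∈ ctx.Pos, 0 < h γ := by
  obtain ⟨h, hh⟩ := ctx.exists_functional fun _ => 1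
  have key : ∀ x ∈ AddSubmonoid.closure (ctx.base : Set V), x = 0 ∨ 0 < h x := by
    intro x hx
    induction hx using AddSubmonoid.closure_induction with
    | mem x hx => right; rw [hh x hx]; exact one_pos
    | zero => exact Or.inl rfl
    | add x y _ _ hx hy =>
      rcases hx with rfl | hx <;> rcases hy with rfl | hy
      · simp
      · simpa using Or.inr hy
      · simpa using Or.inr hx
      · right; rw [map_add]; exact add_pos hx hy
  exact ⟨h, fun γ hγ => (key γ (ctx.pos_coords γ hγ)).resolve_left (ne_zero_of_mem_pos hγ)⟩

/-- A positive root sent to a negative root by subtracting a multiple of the simple root `α` is a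
multiple of `α`. -/
lemma eq_nsmul_of_neg_sub_mem_pos {α γ : V} {c : ℝ} (hα : α ∈ ctx.base) (hγ : γ ∈ ctx.Pos)
    (h : -(γ - c • α) ∈ ctx.Pos) : ∃ n : ℕ, γ = (n : ℝ) • α := by
  obtain ⟨f, hf⟩ := ctx.exists_functional fun β => if β = α then 0 else 1
  have hfα : f α = 0 := by simp [hf α hα]
  have key : ∀ x ∈ AddSubmonoid.closure (ctx.base : Set V),
      (∃ n : ℕ, x = (n : ℝ) • α) ∨ 0 < f x := by
    intro x hx
    induction hx using AddSubmonoid.closure_induction with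
    | mem x hx =>
      by_cases hxα : x = α
      · exact Or.inl ⟨1, by simp [hxα]⟩
      · right; simp [hf x hx, hxα]
    | zero => exact Or.inl ⟨0, by simp⟩
    | add x y _ _ hx hy =>
      rcases hx with ⟨n, rfl⟩ | hx <;> rcases hy with ⟨m, rfl⟩ | hy
      · exact Or.inl ⟨n + m, by push_cast; rw [add_smul]⟩
      · right; simpa [hfα] using hy
      · right; simpa [hfα] using hx
      · right; rw [map_add]; exact add_pos hx hy
  refine (key γ (ctx.pos_coords γ hγ)).resolve_right fun hpos => ?_
  rcases key _ (ctx.pos_coords _ h) with ⟨m, hm⟩ | hm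
  · have := congrArg f hm
    simp [hfα] at this
    linarith
  · simp [hfα] at hm
    linarith

lemma inner_nonpos_of_mem_pos {x γ : V} (hx : ∀ α ∈ ctx.base, ⟪α, x⟫ ≤ 0)
    (hγ : γ ∈ ctx.Pos) : ⟪γ, x⟫ ≤ 0 := by
  have hmem := ctx.pos_coords γ hγ
  clear hγ
  induction hmem using AddSubmonoid.closure_induction with
  | mem γ h => exact hx γ h
  | zero => simp
  | add a b _ _ ha hb => rw [inner_add_left]; exact add_nonpos ha hb

end Positivity

namespace IsSimpleReflection

variable {s : V ≃ₗ[ℝ] V}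

lemma mem_weylGroup (hs : ctx.IsSimpleReflection s) : s ∈ ctx.weylGroup :=
  Subgroup.subset_closure hs

lemma inner_map_map (hs : ctx.IsSimpleReflection s) (x y : V) : ⟪s x, s y⟫ = ⟪x, y⟫ := by
  obtain ⟨α, hα, h⟩ := hs
  have h0 : ⟪α, α⟫ ≠ 0 :=
    inner_self_ne_zero.mpr (ne_zero_of_mem_pos (ctx.base_subset hα))
  rw [h, h, inner_sub_left, inner_sub_right, inner_sub_right, inner_smul_left, inner_smul_right,
    inner_smul_left, inner_smul_right, real_inner_comm y α]
  simp only [conj_trivial]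
  field_simp
  ring

lemma map_root (hs : ctx.IsSimpleReflection s) {γ : V} (hγ : γ ∈ ctx.Δ) : s γ ∈ ctx.Δ := by
  obtain ⟨α, hα, h⟩ := hs
  rw [h]
  exact ctx.reflect_mem α (ctx.pos_subset (ctx.base_subset hα)) γ hγ

end IsSimpleReflection

/-- `s` is the reflection in the simple root `α`. -/
def IsReflectionIn (s : V ≃ₗ[ℝ] V) (α : V) : Prop :=
  ∀ v, s v = v - (2 * ⟪v, α⟫ / ⟪α, α⟫) • α

lemma IsReflectionIn.apply_self {s : V ≃ₗ[ℝ] V} {α : V} (hs : IsReflectionIn s α)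
    (hα : α ∈ ctx.base) : s α = -α := by
  have h0 : ⟪α, α⟫ ≠ 0 :=
    inner_self_ne_zero.mpr (ne_zero_of_mem_pos (ctx.base_subset hα))
  rw [hs α, mul_div_assoc, div_self h0, mul_one, two_smul]
  abel

lemma IsReflectionIn.mul_self {s : V ≃ₗ[ℝ] V} {α : V} (hs : IsReflectionIn s α)
    (hα : α ∈ ctx.base) : s * s = 1 := by
  ext v
  change s (s v) = v
  rw [hs v, map_sub, map_smul, hs.apply_self hα, hs v]
  simp

lemma IsSimpleReflection.mul_self {s : V ≃ₗ[ℝ] V} (hs : ctx.IsSimpleReflection s) :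
    s * s = 1 := by
  obtain ⟨α, hα, h⟩ := hs
  exact IsReflectionIn.mul_self h hα

lemma inner_map_map_of_mem_weylGroup {w : V ≃ₗ[ℝ] V} (hw : w ∈ ctx.weylGroup) (x y : V) :
    ⟪w x, w y⟫ = ⟪x, y⟫ := by
  induction hw using Subgroup.closure_induction generalizing x y with
  | mem s hs => exact IsSimpleReflection.inner_map_map hs x y
  | one => rfl
  | mul a b _ _ ha hb => exact (ha _ _).trans (hb _ _)
  | inv a _ ha =>
    rw [← ha, ← LinearEquiv.mul_apply, ← LinearEquiv.mul_apply, mul_inv_cancel]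
    rfl

/-- Every element of the Weyl group is a product of simple reflections. -/
lemma exists_word {w : V ≃ₗ[ℝ] V} (hw : w ∈ ctx.weylGroup) :
    ∃ l : List (V ≃ₗ[ℝ] V), (∀ s ∈ l, ctx.IsSimpleReflection s) ∧ l.prod = w := by
  induction hw using Subgroup.closure_induction with
  | mem s hs => exact ⟨[s], by simpa using hs, by simp⟩
  | one => exact ⟨[], by simp, rfl⟩
  | mul a b _ _ ha hb =>
    obtain ⟨l, hl, rfl⟩ := ha
    obtain ⟨m, hm, rfl⟩ := hb
    exact ⟨l ++ m, List.forall_mem_append.mpr ⟨hl, hm⟩, List.prod_append⟩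
  | inv a _ ha =>
    obtain ⟨l, hl, rfl⟩ := ha
    refine ⟨(l.map (·⁻¹)).reverse, fun s hs => ?_, (List.prod_inv_reverse l).symm⟩
    obtain ⟨r, hr, rfl⟩ := List.mem_map.mp (List.mem_reverse.mp hs)
    rw [← eq_inv_of_mul_eq_one_left (hl r hr).mul_self]
    exact hl r hr

lemma prod_mem_weylGroup {l : List (V ≃ₗ[ℝ] V)} (hl : ∀ s ∈ l, ctx.IsSimpleReflection s) :
    l.prod ∈ ctx.weylGroup :=
  Subgroup.list_prod_mem _ fun s hs => (hl s hs).mem_weylGroup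

lemma map_root_of_mem_weylGroup {w : V ≃ₗ[ℝ] V} (hw : w ∈ ctx.weylGroup) {γ : V}
    (hγ : γ ∈ ctx.Δ) : w γ ∈ ctx.Δ := by
  obtain ⟨l, hl, rfl⟩ := exists_word hw
  induction l with
  | nil => exact hγ
  | cons s t ih =>
    rw [List.forall_mem_cons] at hl
    rw [List.prod_cons]
    exact hl.1.map_root (ih hl.2 (prod_mem_weylGroup hl.2))

section Length

lemma length_prod_le {l : List (V ≃ₗ[ℝ] V)} (hl : ∀ s ∈ l, ctx.IsSimpleReflection s) :
    ctx.length l.prod ≤ l.length :=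
  Nat.sInf_le ⟨l, rfl, hl, rfl⟩

lemma exists_reduced_word {w : V ≃ₗ[ℝ] V} (hw : w ∈ ctx.weylGroup) :
    ∃ l : List (V ≃ₗ[ℝ] V), l.length = ctx.length w ∧
      (∀ s ∈ l, ctx.IsSimpleReflection s) ∧ l.prod = w := by
  obtain ⟨l, hl, h⟩ := exists_word hw
  exact Nat.sInf_mem (s := {n | ∃ l : List (V ≃ₗ[ℝ] V), l.length = n ∧
    (∀ s ∈ l, ctx.IsSimpleReflection s) ∧ l.prod = w}) ⟨l.length, l, rfl, hl, h⟩

lemma eq_one_of_length_eq_zero {w : V ≃ₗ[ℝ] V} (hw : w ∈ ctx.weylGroup)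
    (h : ctx.length w = 0) : w = 1 := by
  obtain ⟨l, hl, -, rfl⟩ := exists_reduced_word hw
  rw [h, List.length_eq_zero_iff] at hl
  simp [hl]

/-- The exchange condition. -/
lemma exists_word_mul_of_neg_mem_pos {l : List (V ≃ₗ[ℝ] V)}
    (hl : ∀ s ∈ l, ctx.IsSimpleReflection s) {α : V} (hα : α ∈ ctx.base) {r : V ≃ₗ[ℝ] V}
    (hr : IsReflectionIn r α) (hneg : -(l.prod α) ∈ ctx.Pos) :
    ∃ l' : List (V ≃ₗ[ℝ] V), (∀ s ∈ l', ctx.IsSimpleReflection s) ∧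
      l'.length + 1 = l.length ∧ l.prod * r = l'.prod := by
  induction l with
  | nil => exact absurd hneg (ctx.pos_not_neg α (ctx.base_subset hα))
  | cons s t ih =>
    rw [List.forall_mem_cons] at hl
    obtain ⟨hs, ht⟩ := hl
    have htW := prod_mem_weylGroup ht
    have hΔ : t.prod α ∈ ctx.Δ :=
      map_root_of_mem_weylGroup htW (ctx.pos_subset (ctx.base_subset hα))
    rcases ctx.pos_or_neg _ hΔ with hpos | hneg'
    · refine ⟨t, ht, rfl, ?_⟩
      obtain ⟨β, hβ, hsβ⟩ := hs
      rw [List.prod_cons, LinearEquiv.mul_apply, hsβ] at hneg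
      obtain ⟨n, hn⟩ := eq_nsmul_of_neg_sub_mem_pos hβ hpos hneg
      have hn0 : (n : ℝ) ≠ 0 := by
        intro h
        rw [h, zero_smul] at hn
        exact ne_zero_of_mem_pos hpos hn
      have hβ0 : ⟪β, β⟫ ≠ 0 :=
        inner_self_ne_zero.mpr (ne_zero_of_mem_pos (ctx.base_subset hβ))
      have hconj : t.prod * r = s * t.prod := by
        ext v
        rw [LinearEquiv.mul_apply, LinearEquiv.mul_apply, hsβ, hr, map_sub, map_smul,
          ← inner_map_map_of_mem_weylGroup htW v α, ← inner_map_map_of_mem_weylGroup htW α α,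
          hn, smul_smul, inner_smul_left, inner_smul_right, inner_smul_right]
        congr 2
        simp only [conj_trivial]
        field_simp
      rw [List.prod_cons, mul_assoc, hconj, ← mul_assoc,
        IsSimpleReflection.mul_self ⟨β, hβ, hsβ⟩, one_mul]
    · obtain ⟨l', hl', hlen, hprod⟩ := ih ht hneg'
      refine ⟨s :: l', List.forall_mem_cons.mpr ⟨hs, hl'⟩, by simp [hlen], ?_⟩
      rw [List.prod_cons, List.prod_cons, mul_assoc, hprod]

lemma length_mul_add_one_le_of_neg_mem_pos {w r : V ≃ₗ[ℝ] V} (hw : w ∈ ctx.weylGroup) {α : V}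
    (hα : α ∈ ctx.base) (hr : IsReflectionIn r α) (hneg : -(w α) ∈ ctx.Pos) :
    ctx.length (w * r) + 1 ≤ ctx.length w := by
  obtain ⟨l, hlen, hl, rfl⟩ := exists_reduced_word hw
  obtain ⟨l', hl', hlen', h⟩ := exists_word_mul_of_neg_mem_pos hl hα hr hneg
  rw [h, ← hlen, ← hlen']
  exact Nat.succ_le_succ (length_prod_le hl')

lemma length_mul_le {w r : V ≃ₗ[ℝ] V} (hw : w ∈ ctx.weylGroup)
    (hr : ctx.IsSimpleReflection r) : ctx.length (w * r) ≤ ctx.length w + 1 := by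
  obtain ⟨l, hlen, hl, rfl⟩ := exists_reduced_word hw
  have h : ∀ s ∈ l ++ [r], ctx.IsSimpleReflection s := by
    intro s hs
    rcases List.mem_append.mp hs with hs | hs
    · exact hl s hs
    · exact List.mem_singleton.mp hs ▸ hr
  simpa [hlen] using length_prod_le h

/-- An element of positive length has a simple root in its inversion set. -/
lemma exists_neg_mem_pos_of_length_ne_zero {w : V ≃ₗ[ℝ] V} (hw : w ∈ ctx.weylGroup)
    (h : ctx.length w ≠ 0) :
    ∃ α ∈ ctx.base, ∃ r : V ≃ₗ[ℝ] V, IsReflectionIn r α ∧ -(w α) ∈ ctx.Pos := by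
  obtain ⟨l, hlen, hl, rfl⟩ := exists_reduced_word hw
  rcases List.eq_nil_or_concat l with rfl | ⟨t, r, rfl⟩
  · exact absurd hlen.symm h
  have hr : ctx.IsSimpleReflection r := hl r (by simp)
  have ht : ∀ s ∈ t, ctx.IsSimpleReflection s := fun s hs => hl s (by simp [hs])
  have ⟨α, hα, hrα⟩ := hr
  refine ⟨α, hα, r, hrα, ?_⟩
  have hΔ := map_root_of_mem_weylGroup hw (ctx.pos_subset (ctx.base_subset hα))
  refine (ctx.pos_or_neg _ hΔ).resolve_left fun hpos => ?_
  have heq : (t.concat r).prod = t.prod * r := by simp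
  rw [heq, LinearEquiv.mul_apply, IsReflectionIn.apply_self hrα hα, map_neg] at hpos
  have h1 := length_mul_add_one_le_of_neg_mem_pos (prod_mem_weylGroup ht) hα hrα hpos
  have h2 := length_prod_le ht
  rw [heq] at hlen
  simp at hlen
  omega

/-- If the inversion set of `w` is contained in that of `u`, then `w` is no longer than `u`, with
equality of lengths only for `u = w`. -/
lemma length_le_of_inversions_subset {w u : V ≃ₗ[ℝ] V} (hw : w ∈ ctx.weylGroup)
    (hu : u ∈ ctx.weylGroup) (h : ∀ γ ∈ ctx.Pos, -(w γ) ∈ ctx.Pos → -(u γ) ∈ ctx.Pos) :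
    ctx.length w ≤ ctx.length u ∧ (ctx.length u = ctx.length w → u = w) := by
  induction hk : ctx.length w using Nat.strong_induction_on generalizing w u with
  | _ k ih =>
  subst hk
  by_cases h0 : ctx.length w = 0
  · refine ⟨h0 ▸ Nat.zero_le _, fun he => ?_⟩
    rw [eq_one_of_length_eq_zero hw h0, eq_one_of_length_eq_zero hu (he.trans h0)]
  obtain ⟨α, hα, r, hrα, hneg⟩ := exists_neg_mem_pos_of_length_ne_zero hw h0
  have hr : ctx.IsSimpleReflection r := ⟨α, hα, hrα⟩
  have hwr := mul_mem hw hr.mem_weylGroup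
  have hur := mul_mem hu hr.mem_weylGroup
  have hw1 := length_mul_add_one_le_of_neg_mem_pos hw hα hrα hneg
  have hu1 := length_mul_add_one_le_of_neg_mem_pos hu hα hrα
    (h α (ctx.base_subset hα) hneg)
  have hw2 := length_mul_le hwr hr
  rw [mul_assoc, hr.mul_self, mul_one] at hw2
  have hsub : ∀ γ ∈ ctx.Pos, -((w * r) γ) ∈ ctx.Pos → -((u * r) γ) ∈ ctx.Pos := by
    intro γ hγ hγneg
    rw [LinearEquiv.mul_apply] at hγneg ⊢
    rcases ctx.pos_or_neg _ (hr.map_root (ctx.pos_subset hγ)) with hp | hn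
    · exact h _ hp hγneg
    · exfalso
      rw [hrα] at hn
      obtain ⟨n, rfl⟩ := eq_nsmul_of_neg_sub_mem_pos hα hγ hn
      obtain ⟨f, hf⟩ := ctx.exists_height_s10
      have h1 := hf _ hγneg
      have h2 := hf _ hneg
      simp only [map_smul, hrα.apply_self hα, map_neg, smul_eq_mul] at h1 h2
      have h3 : (0 : ℝ) ≤ n := n.cast_nonneg
      nlinarith
  obtain ⟨hle, heq⟩ := ih (ctx.length (w * r)) (by omega) hwr hur hsub rfl
  refine ⟨by omega, fun he => ?_⟩
  exact mul_right_cancel (heq (by omega))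

end Length

end RootSystemCtx

/-- `w_z(z)` is anti-dominant, and `w_z` is the unique element of minimal length of the Weyl
group taking `z` into the anti-dominant chamber `-C`. -/
theorem w_z_antidominant {V : Type*} [NormedAddCommGroup V] [InnerProductSpace ℝ V]
    [FiniteDimensional ℝ V] (ctx : RootSystemCtx V)
    (z : V)
    (hz : ∀ γ ∈ ctx.Pos, ⟪γ, z⟫ = -1 ∨ ⟪γ, z⟫ = 0 ∨ ⟪γ, z⟫ = 1 ∨ ⟪γ, z⟫ = 2)
    (w : V ≃ₗ[ℝ] V) (hw : w ∈ ctx.weylGroup)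
    (hN : ∀ γ ∈ ctx.Pos, (-(w γ) ∈ ctx.Pos ↔ (⟪γ, z⟫ = 1 ∨ ⟪γ, z⟫ = 2))) :
    (∀ α ∈ ctx.base, ⟪α, w z⟫ ≤ 0) ∧
    (∀ u : V ≃ₗ[ℝ] V, u ∈ ctx.weylGroup → (∀ α ∈ ctx.base, ⟪α, u z⟫ ≤ 0) →
      ctx.length w ≤ ctx.length u ∧ (ctx.length u = ctx.length w → u = w)) := by
  refine ⟨fun α hα => ?_, fun u hu hanti => ?_⟩
  · have hαΔ := ctx.pos_subset (ctx.base_subset hα)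
    have hinv := inv_mem hw
    have hcancel : w (w⁻¹ α) = α := by
      rw [← LinearEquiv.mul_apply, mul_inv_cancel]; rfl
    have hinner : ⟪α, w z⟫ = ⟪w⁻¹ α, z⟫ := by
      rw [← RootSystemCtx.inner_map_map_of_mem_weylGroup hw (w⁻¹ α) z, hcancel]
    rw [hinner]
    rcases ctx.pos_or_neg _ (RootSystemCtx.map_root_of_mem_weylGroup hinv hαΔ) with hp | hn
    · have hnot : ¬ -(w (w⁻¹ α)) ∈ ctx.Pos := by
        rw [hcancel]; exact ctx.pos_not_neg α (ctx.base_subset hα)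
      rw [hN _ hp] at hnot
      rcases hz _ hp with h | h | h
      · linarith
      · exact h.le
      · exact absurd h hnot
    · have hmem : -(w (-(w⁻¹ α))) ∈ ctx.Pos := by
        rw [map_neg, neg_neg, hcancel]; exact ctx.base_subset hα
      rw [hN _ hn, inner_neg_left] at hmem
      rcases hmem with h | h <;> linarith
  · refine RootSystemCtx.length_le_of_inversions_subset hw hu fun γ hγ hneg => ?_
    have hpos : 0 < ⟪γ, z⟫ := by
      rcases (hN γ hγ).mp hneg with h | h <;> rw [h] <;> norm_num
    have hΔ := RootSystemCtx.map_root_of_mem_weylGroup hu (ctx.pos_subset hγ)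
    refine (ctx.pos_or_neg _ hΔ).resolve_left fun hp => ?_
    have hle := RootSystemCtx.inner_nonpos_of_mem_pos hanti hp
    rw [RootSystemCtx.inner_map_map_of_mem_weylGroup hu] at hle
    exact hpos.not_ge hle
end
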